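/- Bound on the optimal dual variable (Lemma 1). Assume Slater's condition with margin ξ ∈ (0,1], let π* be an optimal feasible policy, and let λ* ∈ ℝ^N witness strong duality (λ*_i ≥ 0 for all i and sup_π V_L^{π,λ*}(ρ) = V_0^{π*}(ρ)). Then max_{1≤i≤N} λ*_i ≤ 2/(ξ(1−γ)). -/

import Mathlib

open Finset

/-- `π` is a (Markov, stationary) policy: a probability distribution over actions per state. -/
def IsPolicy {S A : Type*} [Fintype A] (π : S → A → ℝ) : Prop :=
  (∀ s a, 0 ≤ π s a) ∧ ∀ s, ∑ a, π s a = 1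

/-- `P` is a transition kernel. -/
def IsKernel {S A : Type*} [Fintype S] (P : S → A → S → ℝ) : Prop :=
  (∀ s a s', 0 ≤ P s a s') ∧ ∀ s a, ∑ s', P s a s' = 1

/-- `ρ` is a probability distribution on `S`. -/
def IsDist {S : Type*} [Fintype S] (ρ : S → ℝ) : Prop :=
  (∀ s, 0 ≤ ρ s) ∧ ∑ s, ρ s = 1

/-- `Q` solves the Bellman equation `Q = r + γ P^π Q` for reward `r`, kernel `P`,
discount `γ` and policy `π` (for `γ ∈ (0,1)` the solution exists and is unique). -/
def IsBellman {S A : Type*} [Fintype S] [Fintype A]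
    (P : S → A → S → ℝ) (γ : ℝ) (r : S → A → ℝ) (π : S → A → ℝ)
    (Q : S → A → ℝ) : Prop :=
  ∀ s a, Q s a = r s a + γ * ∑ s', P s a s' * ∑ a', π s' a' * Q s' a'

/-- The value `V^π(ρ) = ∑_s ρ(s) ∑_a π(a|s) Q(s,a)` computed from a `Q`-table. -/
def Vval {S A : Type*} [Fintype S] [Fintype A]
    (ρ : S → ℝ) (π : S → A → ℝ) (Q : S → A → ℝ) : ℝ :=
  ∑ s, ρ s * ∑ a, π s a * Q s a

/-- Advantage computed from a `Q`-table: `A(s,a) = Q(s,a) − ∑_{a'} π(a'|s) Q(s,a')`. -/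
def adv {S A : Type*} [Fintype A] (π : S → A → ℝ) (Q : S → A → ℝ)
    (s : S) (a : A) : ℝ :=
  Q s a - ∑ a', π s a' * Q s a'

/-- Euclidean norm of a table on `S × A` viewed as a vector in `ℝ^{|S||A|}`. -/
noncomputable def tnorm {S A : Type*} [Fintype S] [Fintype A] (f : S → A → ℝ) : ℝ :=
  Real.sqrt (∑ s, ∑ a, (f s a) ^ 2)

/-- Sup norm of a table on `S × A`. -/
noncomputable def supnorm {S A : Type*} [Fintype S] [Fintype A] (f : S → A → ℝ) : ℝ :=
  ⨆ p : S × A, |f p.1 p.2|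

/-- A weighted average of numbers in `[c, d]` lies in `[c, d]`. -/
lemma weighted_average_mem_Icc {ι : Type*} [Fintype ι] {w x : ι → ℝ} {c d : ℝ}
    (hw : ∀ i, 0 ≤ w i) (hw1 : ∑ i, w i = 1) (hx : ∀ i, x i ∈ Set.Icc c d) :
    ∑ i, w i * x i ∈ Set.Icc c d := by
  simpa using (convex_Icc c d).sum_mem (fun i _ => hw i) hw1 (fun i _ => hx i)

/-- Solutions of the Bellman equation with rewards in `[0, 1]` take values in `[0, 1/(1-γ)]`. -/
lemma IsBellman.mem_Icc {S A : Type*} [Fintype S] [Fintype A]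
    {P : S → A → S → ℝ} {γ : ℝ} {r π Q : S → A → ℝ}
    (hQ : IsBellman P γ r π Q) (hP : IsKernel P) (hπ : IsPolicy π) (hγ : γ ∈ Set.Ioo (0 : ℝ) 1)
    (hr : ∀ s a, r s a ∈ Set.Icc (0 : ℝ) 1) (s : S) (a : A) :
    Q s a ∈ Set.Icc 0 (1 / (1 - γ)) := by
  obtain ⟨hγ0, hγ1⟩ := hγ
  have : Nonempty (S × A) := ⟨(s, a)⟩
  obtain ⟨⟨s₁, a₁⟩, hmax⟩ := Finite.exists_max fun p : S × A => Q p.1 p.2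
  obtain ⟨⟨s₀, a₀⟩, hmin⟩ := Finite.exists_min fun p : S × A => Q p.1 p.2
  have havg (t : S) (u : A) :
      ∑ s', P t u s' * ∑ a', π s' a' * Q s' a' ∈ Set.Icc (Q s₀ a₀) (Q s₁ a₁) :=
    weighted_average_mem_Icc (hP.1 t u) (hP.2 t u) fun s' =>
      weighted_average_mem_Icc (hπ.1 s') (hπ.2 s') fun a' => ⟨hmin (s', a'), hmax (s', a')⟩
  have hlow : 0 ≤ Q s₀ a₀ := by
    have := mul_le_mul_of_nonneg_left (havg s₀ a₀).1 hγ0.le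
    have := hQ s₀ a₀
    have := (hr s₀ a₀).1
    nlinarith
  have hupp : Q s₁ a₁ ≤ 1 / (1 - γ) := by
    rw [le_div_iff₀ (by linarith)]
    have := mul_le_mul_of_nonneg_left (havg s₁ a₁).2 hγ0.le
    have := hQ s₁ a₁
    have := (hr s₁ a₁).2
    nlinarith
  exact ⟨hlow.trans (hmin (s, a)), (hmax (s, a)).trans hupp⟩

/-- Values of policies with rewards in `[0, 1]` lie in `[0, 1/(1-γ)]`. -/
lemma IsBellman.vval_mem_Icc {S A : Type*} [Fintype S] [Fintype A]
    {P : S → A → S → ℝ} {γ : ℝ} {r π Q : S → A → ℝ} {ρ : S → ℝ}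
    (hQ : IsBellman P γ r π Q) (hP : IsKernel P) (hπ : IsPolicy π) (hγ : γ ∈ Set.Ioo (0 : ℝ) 1)
    (hr : ∀ s a, r s a ∈ Set.Icc (0 : ℝ) 1) (hρ : IsDist ρ) :
    Vval ρ π Q ∈ Set.Icc 0 (1 / (1 - γ)) :=
  weighted_average_mem_Icc hρ.1 hρ.2 fun s =>
    weighted_average_mem_Icc (hπ.1 s) (hπ.2 s) fun a => hQ.mem_Icc hP hπ hγ hr s a

/-- Lemma 1: under Slater's condition with margin `ξ`, any nonnegative
dual vector `λ*` witnessing strong duality satisfies `λ*_i ≤ 2/(ξ(1−γ))` for every `i`. -/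
theorem optimal_dual_variable_bound
    {S A : Type*} [Fintype S] [Fintype A] [Nonempty S] [Nonempty A]
    (N : ℕ) (hN : 1 ≤ N)
    (P : S → A → S → ℝ) (hP : IsKernel P)
    (γ : ℝ) (hγ : γ ∈ Set.Ioo (0:ℝ) 1)
    (r0 : S → A → ℝ) (hr0 : ∀ s a, r0 s a ∈ Set.Icc (0:ℝ) 1)
    (rg : Fin N → S → A → ℝ) (hrg : ∀ i s a, rg i s a ∈ Set.Icc (0:ℝ) 1)
    (ρ : S → ℝ) (hρ : IsDist ρ)
    (b : Fin N → ℝ) (hb : ∀ i, b i ∈ Set.Icc (0:ℝ) (1/(1-γ)))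
    (Q0 : (S → A → ℝ) → S → A → ℝ) (Qg : Fin N → (S → A → ℝ) → S → A → ℝ)
    (hQ0 : ∀ π, IsPolicy π → IsBellman P γ r0 π (Q0 π))
    (hQg : ∀ i π, IsPolicy π → IsBellman P γ (rg i) π (Qg i π))
    (ξ : ℝ) (hξ : ξ ∈ Set.Ioc (0:ℝ) 1)
    (hSlater : ∃ πb, IsPolicy πb ∧ ∀ i, Vval ρ πb (Qg i πb) - b i ≥ ξ)
    (πstar : S → A → ℝ) (hπs : IsPolicy πstar)
    (hfeas : ∀ i, Vval ρ πstar (Qg i πstar) ≥ b i)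
    (hopt : ∀ π, IsPolicy π → (∀ i, Vval ρ π (Qg i π) ≥ b i) →
      Vval ρ π (Q0 π) ≤ Vval ρ πstar (Q0 πstar))
    (lamstar : Fin N → ℝ) (hlamnn : ∀ i, 0 ≤ lamstar i)
    (hSD : sSup {x : ℝ | ∃ π, IsPolicy π ∧
        x = Vval ρ π (Q0 π) + ∑ i, lamstar i * (Vval ρ π (Qg i π) - b i)}
      = Vval ρ πstar (Q0 πstar)) :
    ∀ i, lamstar i ≤ 2 / (ξ * (1 - γ)) := by
  intro i
  have hγ' : 0 < 1 - γ := sub_pos.2 hγ.2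
  have hV0 (π) (hπ : IsPolicy π) := (hQ0 π hπ).vval_mem_Icc hP hπ hγ hr0 hρ
  have hVg (j) (π) (hπ : IsPolicy π) := (hQg j π hπ).vval_mem_Icc hP hπ hγ (hrg j) hρ
  obtain ⟨πb, hπb, hslack⟩ := hSlater
  have hbdd : BddAbove {x : ℝ | ∃ π, IsPolicy π ∧
      x = Vval ρ π (Q0 π) + ∑ i, lamstar i * (Vval ρ π (Qg i π) - b i)} := by
    refine ⟨1 / (1 - γ) + ∑ j, lamstar j * (1 / (1 - γ)), ?_⟩
    rintro x ⟨π, hπ, rfl⟩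
    refine add_le_add (hV0 π hπ).2 (Finset.sum_le_sum fun j _ => ?_)
    exact mul_le_mul_of_nonneg_left (by linarith [(hVg j π hπ).2, (hb j).1]) (hlamnn j)
  have hdual := le_csSup hbdd ⟨πb, hπb, rfl⟩
  rw [hSD] at hdual
  have hterm : lamstar i * ξ ≤ ∑ j, lamstar j * (Vval ρ πb (Qg j πb) - b j) :=
    (mul_le_mul_of_nonneg_left (hslack i) (hlamnn i)).trans <|
      Finset.single_le_sum
        (f := fun j => lamstar j * (Vval ρ πb (Qg j πb) - b j))
        (fun j _ => mul_nonneg (hlamnn j) (hξ.1.le.trans (hslack j))) (Finset.mem_univ i)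
  have hmain : lamstar i * ξ ≤ 1 / (1 - γ) := by
    linarith [(hV0 πb hπb).1, (hV0 πstar hπs).2]
  rw [le_div_iff₀ hγ'] at hmain
  rw [le_div_iff₀ (mul_pos hξ.1 hγ')]
  linarith
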